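/- Let p > 0. Define g₋ : ℤ → ℝ by g₋(0) = 1, g₋(−1) = p, and g₋(m) = 0 otherwise (the Laurent coefficients of 1+pz^{−1}), and g₊ : ℤ → ℝ by g₊(0) = 1, g₊(1) = p, and g₊(m) = 0 otherwise (the coefficients of 1+pz). Then for all λ, μ ∈ 𝒲ₙ: det[g₋((λⱼ−j)−(μᵢ−i))]_{i,j=1}^n equals p^{Σᵢ(μᵢ−λᵢ)} if μᵢ − λᵢ ∈ {0,1} for every i, and equals 0 otherwise; and det[g₊((λⱼ−j)−(μᵢ−i))]_{i,j=1}^n equals p^{Σᵢ(λᵢ−μᵢ)} if λᵢ − μᵢ ∈ {0,1} for every i, and equals 0 otherwise. -/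

import Mathlib

open scoped BigOperators
open scoped Classical

/-- A signature of length `n`: a nonincreasing `n`-tuple of integers. -/
def Sig (n : ℕ) : Type := {f : Fin n → ℤ // ∀ i j : Fin n, i ≤ j → f j ≤ f i}

/-- The determinant of a kernel supported on two consecutive integers, evaluated at differences of
strictly decreasing sequences, reduces to its diagonal product. -/
theorem det_kernel_sub_eq_prod {n : ℕ} {R : Type*} [CommRing R] (k : ℤ → R) (c : ℤ)
    (hk : ∀ m, m ≠ c → m ≠ c + 1 → k m = 0) {a b : Fin n → ℤ}
    (ha : StrictAnti a) (hb : StrictAnti b) :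
    Matrix.det (Matrix.of fun i j : Fin n => k (a j - b i)) = ∏ i, k (a i - b i) := by
  rw [Matrix.det_apply, Finset.sum_eq_single (1 : Equiv.Perm (Fin n))]
  · simp
  · intro σ _ hσ
    suffices h : ∃ i, k (a i - b (σ i)) = 0 by
      obtain ⟨i, hi⟩ := h
      rw [Finset.prod_eq_zero (Finset.mem_univ i) (by simpa using hi), smul_zero]
    by_contra! h
    have hsupp (i : Fin n) : a i - b (σ i) = c ∨ a i - b (σ i) = c + 1 := by
      by_contra! hi
      exact h i (hk _ hi.1 hi.2)
    have hmono : StrictMono σ := by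
      intro i j hij
      by_contra! hle
      have hlt : σ j < σ i := lt_of_le_of_ne hle fun e => hij.ne' (σ.injective e)
      have := ha hij
      have := hb hlt
      have := hsupp i
      have := hsupp j
      omega
    refine hσ (Equiv.ext fun i => ?_)
    exact congrFun ((hmono.range_inj strictMono_id).1 (by simp)) i
  · simp

theorem prod_zpow_eq_zpow_sum {ι K : Type*} [Field K] {p : K} (hp : p ≠ 0) (s : Finset ι)
    (f : ι → ℤ) : ∏ i ∈ s, p ^ f i = p ^ ∑ i ∈ s, f i := by
  induction s using Finset.cons_induction with
  | empty => simp
  | cons a s ha ih => rw [Finset.prod_cons, Finset.sum_cons, zpow_add₀ hp, ih]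

theorem prod_bernoulli_eq_ite {ι K : Type*} [Fintype ι] [Field K] {p : K} (hp : p ≠ 0)
    (d : ι → ℤ) [Decidable (∀ i, d i = 0 ∨ d i = 1)] :
    ∏ i, (if d i = 0 then 1 else if d i = 1 then p else 0) =
      if ∀ i, d i = 0 ∨ d i = 1 then p ^ ∑ i, d i else 0 := by
  split_ifs with h
  · rw [← prod_zpow_eq_zpow_sum hp]
    refine Finset.prod_congr rfl fun i _ => ?_
    rcases h i with hi | hi <;> simp [hi]
  · push Not at h
    obtain ⟨i, hi⟩ := h
    exact Finset.prod_eq_zero (Finset.mem_univ i) (by simp [hi])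

theorem Sig.strictAnti_sub_index {n : ℕ} (l : Sig n) :
    StrictAnti fun i : Fin n => l.1 i - ((i : ℕ) : ℤ) := by
  intro i j hij
  have := l.2 i j hij.le
  have : (i : ℕ) < j := hij
  dsimp only
  omega

/-- Determinantal evaluation for the Bernoulli kernels: with
`g₋ = 1_{m=0} + p·1_{m=-1}` and `g₊ = 1_{m=0} + p·1_{m=1}`,
`det[g₋((λⱼ−j)−(μᵢ−i))] = p^{Σ(μᵢ−λᵢ)} 1_{∀i, μᵢ−λᵢ∈{0,1}}` and
`det[g₊((λⱼ−j)−(μᵢ−i))] = p^{Σ(λᵢ−μᵢ)} 1_{∀i, λᵢ−μᵢ∈{0,1}}`. -/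
theorem det_bernoulli_kernels
    (n : ℕ) (hn : 1 ≤ n) (p : ℝ) (hp : 0 < p)
    (gminus gplus : ℤ → ℝ)
    (hgminus : ∀ m : ℤ, gminus m = if m = 0 then 1 else if m = -1 then p else 0)
    (hgplus : ∀ m : ℤ, gplus m = if m = 0 then 1 else if m = 1 then p else 0) :
    ∀ l m : Sig n,
      (Matrix.det (Matrix.of fun i j : Fin n =>
          gminus ((l.1 j - (j : ℕ)) - (m.1 i - (i : ℕ))))
        = if ∀ i : Fin n, m.1 i - l.1 i = 0 ∨ m.1 i - l.1 i = 1
          then p ^ (∑ i : Fin n, (m.1 i - l.1 i)) else 0) ∧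
      (Matrix.det (Matrix.of fun i j : Fin n =>
          gplus ((l.1 j - (j : ℕ)) - (m.1 i - (i : ℕ))))
        = if ∀ i : Fin n, l.1 i - m.1 i = 0 ∨ l.1 i - m.1 i = 1
          then p ^ (∑ i : Fin n, (l.1 i - m.1 i)) else 0) := by
  intro l m
  constructor
  · rw [det_kernel_sub_eq_prod gminus (-1) (fun d h₁ h₀ => by
      rw [hgminus, if_neg (by simpa using h₀), if_neg h₁])
      l.strictAnti_sub_index m.strictAnti_sub_index,
      ← prod_bernoulli_eq_ite hp.ne' fun i => m.1 i - l.1 i]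
    refine Finset.prod_congr rfl fun i _ => ?_
    rw [hgminus]
    congr 1
    · exact propext (by omega)
    · congr 1
      exact propext (by omega)
  · rw [det_kernel_sub_eq_prod gplus 0 (fun d h₀ h₁ => by
      rw [hgplus, if_neg h₀, if_neg (by simpa using h₁)])
      l.strictAnti_sub_index m.strictAnti_sub_index,
      ← prod_bernoulli_eq_ite hp.ne' fun i => l.1 i - m.1 i]
    refine Finset.prod_congr rfl fun i _ => ?_
    rw [hgplus, sub_sub_sub_cancel_right]
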